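/- In SU(N) lattice gauge theory on the periodic d-dimensional hypercubic lattice Λ, if V and V′ are two distinct homologous vortices (both associated to the same pair of directions (μ,ν)), then for all k, k′ ∈ {0,…,N−1}: ⟨O^[k][V] · O^[k′][V′]⟩ = ⟨O^[k+k′ mod N][V]⟩, where the left-hand side is the expectation of the product of the two vortex-creation insertions. -/

import Mathlib

/-!
Setup: SU(N) lattice gauge theory on a periodic d-dimensional hypercubic lattice.
Sites are `(i : Fin d) → ZMod (L i)`; a configuration assigns an element of `SU N`
to each link `(x, μ)`.  `Pm` is the product of the normalized Haar measure `μH`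
(hypothesized as a left-invariant probability measure) over all links, and the
Gibbs weight is `exp ((β/N) Σ_p Re Tr U_p)`.  A vortex for directions `μ < ν` is
specified by coordinates `c1 : ZMod (L μ)`, `c2 : ZMod (L ν)`; `Ovort` is the
vortex creation operator, `Fop` the electric-flux operator, `Ztw` the twisted
partition function, and `rectHol` the holonomy around a rectangular loop.
-/

open MeasureTheory

namespace TYLGT

noncomputable instance (n : ℕ) : MeasurableSpace (Matrix (Fin n) (Fin n) ℂ) :=
  inferInstanceAs (MeasurableSpace (Fin n → Fin n → ℂ))

/-- The special unitary group `SU(N)` as a subgroup of the unitary group of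
`N × N` complex matrices. -/
def SU (N : ℕ) : Subgroup (Matrix.unitaryGroup (Fin N) ℂ) where
  carrier := {A | (A : Matrix (Fin N) (Fin N) ℂ).det = 1}
  mul_mem' := by
    intro a b ha hb
    simp only [Set.mem_setOf_eq, Matrix.UnitaryGroup.mul_val, Matrix.det_mul] at *
    rw [ha, hb, mul_one]
  one_mem' := by simp
  inv_mem' := by
    intro a ha
    simp only [Set.mem_setOf_eq] at *
    rw [Matrix.UnitaryGroup.inv_val, Matrix.star_eq_conjTranspose, Matrix.det_conjTranspose, ha,
      star_one]

/-- The underlying matrix of an element of `SU(N)`. -/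
def toM {N : ℕ} (U : SU N) : Matrix (Fin N) (Fin N) ℂ :=
  ((U : Matrix.unitaryGroup (Fin N) ℂ) : Matrix (Fin N) (Fin N) ℂ)

/-- `z = exp(2πi/N)`, the generator of the center `Z_N ⊆ SU(N)`. -/
noncomputable def zc (N : ℕ) : ℂ := Complex.exp (2 * Real.pi * Complex.I / N)

variable {d N : ℕ}

/-- Sites of the periodic hypercubic lattice with side lengths `L i`. -/
abbrev Site (L : Fin d → ℕ) := (i : Fin d) → ZMod (L i)

/-- A lattice gauge field configuration: one `SU(N)` element per link `(x, μ)`. -/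
abbrev Config (L : Fin d → ℕ) (N : ℕ) := (Site L × Fin d) → SU N

/-- The unit lattice vector in direction `μ`. -/
def e (L : Fin d → ℕ) (μ : Fin d) : Site L := fun i => if i = μ then 1 else 0

/-- The plaquette variable `U_p = U_{x,μ} U_{x+μ̂,ν} U_{x+ν̂,μ}⁻¹ U_{x,ν}⁻¹`. -/
noncomputable def plaqSU (L : Fin d → ℕ) (U : Config L N) (x : Site L) (μ ν : Fin d) : SU N :=
  U (x, μ) * U (x + e L μ, ν) * (U (x + e L ν, μ))⁻¹ * (U (x, ν))⁻¹

/-- The Wilson action `(β/N) Σ_x Σ_{μ<ν} Re Tr U_p`. -/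
noncomputable def S0 (L : Fin d → ℕ) [∀ i, NeZero (L i)] (β : ℝ) (U : Config L N) : ℝ :=
  β / N * ∑ x : Site L, ∑ μ : Fin d, ∑ ν : Fin d,
    if μ < ν then ((toM (plaqSU L U x μ ν)).trace).re else 0

/-- The Gibbs weight `exp(S0)`. -/
noncomputable def wt (L : Fin d → ℕ) [∀ i, NeZero (L i)] (β : ℝ) (U : Config L N) : ℝ :=
  Real.exp (S0 L β U)

/-- The product over all links of the single-link measure `μH`. -/
noncomputable def Pm (L : Fin d → ℕ) [∀ i, NeZero (L i)] (μH : Measure (SU N))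
    [IsProbabilityMeasure μH] : Measure (Config L N) :=
  Measure.pi fun _ => μH

/-- The partition function `Z_Λ`. -/
noncomputable def Zpart (L : Fin d → ℕ) [∀ i, NeZero (L i)] (μH : Measure (SU N))
    [IsProbabilityMeasure μH] (β : ℝ) : ℝ :=
  ∫ U, wt L β U ∂(Pm L μH)

/-- Expectation value of a complex observable. -/
noncomputable def expecC (L : Fin d → ℕ) [∀ i, NeZero (L i)] (μH : Measure (SU N))
    [IsProbabilityMeasure μH] (β : ℝ) (f : Config L N → ℂ) : ℂ :=
  (∫ U, f U * (wt L β U : ℂ) ∂(Pm L μH)) / (Zpart L μH β : ℂ)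

/-- Expectation value of a real observable. -/
noncomputable def expecR (L : Fin d → ℕ) [∀ i, NeZero (L i)] (μH : Measure (SU N))
    [IsProbabilityMeasure μH] (β : ℝ) (f : Config L N → ℝ) : ℝ :=
  (∫ U, f U * wt L β U ∂(Pm L μH)) / Zpart L μH β

/-- The ordered product of link variables along a straight path of `l` links starting
at `x` in direction `μ`. -/
noncomputable def pathProd (L : Fin d → ℕ) (U : Config L N) (x : Site L) (μ : Fin d) (l : ℕ) :
    SU N :=
  ((List.range l).map fun j => U (x + j • e L μ, μ)).prod

/-- The holonomy around the rectangular loop with corner `x`, sides `lμ`, `lν` in the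
`μ`-`ν` coordinate plane. -/
noncomputable def rectHol (L : Fin d → ℕ) (U : Config L N) (x : Site L) (μ ν : Fin d)
    (lμ lν : ℕ) : SU N :=
  pathProd L U x μ lμ * pathProd L U (x + lμ • e L μ) ν lν *
    (pathProd L U (x + lν • e L ν) μ lμ)⁻¹ * (pathProd L U x ν lν)⁻¹

/-- The vortex creation operator `O^[k][V]` for the vortex with μν-orientation and
coordinates `(c1, c2)`:
`exp((β/N) Σ_{p ⊂ V} [Re Tr(z^k U_p) − Re Tr U_p])`. -/
noncomputable def Ovort (L : Fin d → ℕ) [∀ i, NeZero (L i)] (β : ℝ) {μ ν : Fin d}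
    (c1 : ZMod (L μ)) (c2 : ZMod (L ν)) (k : ℕ) (U : Config L N) : ℝ :=
  Real.exp (β / N * ∑ x : Site L,
    if x μ = c1 ∧ x ν = c2 then
      (zc N ^ k * (toM (plaqSU L U x μ ν)).trace).re - ((toM (plaqSU L U x μ ν)).trace).re
    else 0)

/-- The electric flux creation operator `F^[m][V] = (1/N) Σ_k z^{mk} O^[k][V]`. -/
noncomputable def Fop (L : Fin d → ℕ) [∀ i, NeZero (L i)] (β : ℝ) {μ ν : Fin d}
    (c1 : ZMod (L μ)) (c2 : ZMod (L ν)) (m : ℕ) (U : Config L N) : ℂ :=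
  (N : ℂ)⁻¹ * ∑ k ∈ Finset.range N, zc N ^ (m * k) * (Ovort L β c1 c2 k U : ℂ)

/-- The twisted partition function `Z_Λ^[k] = Z_Λ ⟨O^[k][V]⟩`. -/
noncomputable def Ztw (L : Fin d → ℕ) [∀ i, NeZero (L i)] (μH : Measure (SU N))
    [IsProbabilityMeasure μH] (β : ℝ) {μ ν : Fin d} (c1 : ZMod (L μ)) (c2 : ZMod (L ν))
    (k : ℕ) : ℝ :=
  ∫ U, Ovort L β c1 c2 k U * wt L β U ∂(Pm L μH)

end TYLGT

namespace TYLGT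

/-- On the cycle `ZMod n`, a difference of two point masses is a discrete derivative. -/
lemma exists_sub_eq_indicator_sub (n : ℕ) [NeZero n] (p q : ZMod n) :
    ∃ g : ZMod n → ℤ, ∀ a, g (a + 1) - g a =
      (if a = p then 1 else 0) - (if a = q then 1 else 0) := by
  have key : ∀ m : ℕ, ∃ g : ZMod n → ℤ, ∀ a, g (a + 1) - g a =
      (if a = q + m then 1 else 0) - (if a = q then 1 else 0) := by
    intro m
    induction m with
    | zero => exact ⟨0, by simp⟩
    | succ m ih =>
      obtain ⟨g, hg⟩ := ih
      refine ⟨fun a => g a - if a = q + m + 1 then 1 else 0, fun a => ?_⟩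
      have h := hg a
      simp only [add_left_inj, Nat.cast_add, Nat.cast_one, ← add_assoc]
      linarith
  obtain ⟨g, hg⟩ := key (p - q).val
  refine ⟨g, fun a => ?_⟩
  rw [hg a, ZMod.natCast_zmod_val, add_sub_cancel]

/-- On a discrete two-dimensional torus, a difference of two point masses is a coboundary. -/
lemma exists_coboundary_eq_indicator_sub (m n : ℕ) [NeZero m] [NeZero n]
    (c c' : ZMod m × ZMod n) :
    ∃ s t : ZMod m → ZMod n → ℤ, ∀ a b, s a b + t (a + 1) b - s a (b + 1) - t a b =
      (if a = c.1 ∧ b = c.2 then 1 else 0) - (if a = c'.1 ∧ b = c'.2 then 1 else 0) := by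
  obtain ⟨g, hg⟩ := exists_sub_eq_indicator_sub m c.1 c'.1
  obtain ⟨h, hh⟩ := exists_sub_eq_indicator_sub n c.2 c'.2
  refine ⟨fun a b => if a = c'.1 then -h b else 0, fun a b => if b = c.2 then g a else 0,
    fun a b => ?_⟩
  have h1 := hg a
  have h2 := hh b
  by_cases p1 : a = c.1 <;> by_cases p2 : a = c'.1 <;> by_cases p3 : b = c.2 <;>
    by_cases p4 : b = c'.2 <;> simp only [p1, p2, p3, p4, if_true, if_false, and_true, and_false,
      true_and, false_and, and_self] at h1 h2 ⊢ <;> grind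

lemma zc_ne_zero (N : ℕ) : zc N ≠ 0 := Complex.exp_ne_zero _

lemma zc_pow_self {N : ℕ} (hN : N ≠ 0) : zc N ^ N = 1 :=
  (Complex.isPrimitiveRoot_exp N hN).pow_eq_one

lemma zc_pow_mod {N : ℕ} (hN : N ≠ 0) (k : ℕ) : zc N ^ (k % N) = zc N ^ k :=
  (pow_eq_pow_mod k (zc_pow_self hN)).symm

lemma star_zc_mul_zc {N : ℕ} (hN : N ≠ 0) : star (zc N) * zc N = 1 := by
  have h : ‖zc N‖ = 1 := Complex.norm_eq_one_of_pow_eq_one (zc_pow_self hN) hN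
  rw [Complex.star_def, Complex.conj_mul', h]
  simp

/-- The central element `z · 1` of `SU(N)`. -/
noncomputable def centerSU (N : ℕ) (hN : N ≠ 0) : SU N :=
  ⟨⟨zc N • (1 : Matrix (Fin N) (Fin N) ℂ), by
    rw [Matrix.mem_unitaryGroup_iff', star_smul, star_one, smul_mul_smul_comm, mul_one,
      star_zc_mul_zc hN, one_smul]⟩, by
    change (zc N • (1 : Matrix (Fin N) (Fin N) ℂ)).det = 1
    simp [zc_pow_self hN]⟩

lemma toM_injective {N : ℕ} : Function.Injective (toM : SU N → _) :=
  fun _ _ h => Subtype.ext (Subtype.ext h)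

lemma toM_mul {N : ℕ} (u v : SU N) : toM (u * v) = toM u * toM v := rfl

lemma toM_centerSU {N : ℕ} (hN : N ≠ 0) :
    toM (centerSU N hN) = zc N • (1 : Matrix (Fin N) (Fin N) ℂ) := rfl

lemma toM_centerSU_mul {N : ℕ} (hN : N ≠ 0) (u : SU N) :
    toM (centerSU N hN * u) = zc N • toM u := by
  rw [toM_mul, toM_centerSU, smul_mul_assoc, one_mul]

lemma centerSU_commute {N : ℕ} (hN : N ≠ 0) (u : SU N) : Commute (centerSU N hN) u := by
  apply toM_injective
  rw [toM_centerSU_mul, toM_mul, toM_centerSU, mul_smul_comm, mul_one]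

lemma toM_centerSU_zpow_mul {N : ℕ} (hN : N ≠ 0) (n : ℤ) (u : SU N) :
    toM (centerSU N hN ^ n * u) = zc N ^ n • toM u := by
  induction n with
  | zero => simp
  | succ n ih =>
    rw [add_comm, zpow_add, zpow_one, mul_assoc, toM_centerSU_mul, ih, smul_smul,
      zpow_add₀ (zc_ne_zero N), zpow_one]
  | pred n ih =>
    have h := toM_centerSU_mul hN (centerSU N hN ^ (-(n : ℤ) - 1) * u)
    rw [← mul_assoc, ← zpow_one_add, add_sub_cancel, ih] at h
    rw [zpow_sub_one₀ (zc_ne_zero N), mul_comm, mul_smul, h, inv_smul_smul₀ (zc_ne_zero N)]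

lemma zpow_mul_plaquette {G : Type*} [Group G] {z : G} (hz : ∀ u, Commute z u)
    (p q r s : ℤ) (u₁ u₂ u₃ u₄ : G) :
    z ^ p * u₁ * (z ^ q * u₂) * (z ^ r * u₃)⁻¹ * (z ^ s * u₄)⁻¹ =
      z ^ (p + q - r - s) * (u₁ * u₂ * u₃⁻¹ * u₄⁻¹) := by
  have c (n : ℤ) (u v : G) : u * (z ^ n * v) = z ^ n * (u * v) := by
    rw [← mul_assoc, ← ((hz u).zpow_left n).eq, mul_assoc]
  have i (n : ℤ) (u : G) : (z ^ n * u)⁻¹ = z ^ (-n) * u⁻¹ := by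
    rw [mul_inv_rev, ← zpow_neg, ((hz u⁻¹).zpow_left (-n)).eq]
  rw [i, i, c, mul_assoc (z ^ p), c, c, c]
  rw [show p + q - r - s = -s + (-r + (q + p)) by ring]
  simp only [zpow_add, mul_assoc]

/-- The `Z_N` transformation multiplying the link variable `U_b` by `z ^ n b`. -/
noncomputable def centerTwist {d N : ℕ} (hN : N ≠ 0) (L : Fin d → ℕ) (n : Site L × Fin d → ℤ)
    (U : Config L N) : Config L N :=
  fun b => centerSU N hN ^ n b * U b

lemma trace_plaqSU_centerTwist {d N : ℕ} (hN : N ≠ 0) (L : Fin d → ℕ)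
    (n : Site L × Fin d → ℤ) (U : Config L N) (x : Site L) (α γ : Fin d) :
    (toM (plaqSU L (centerTwist hN L n U) x α γ)).trace =
      zc N ^ (n (x, α) + n (x + e L α, γ) - n (x + e L γ, α) - n (x, γ)) *
        (toM (plaqSU L U x α γ)).trace := by
  rw [← smul_eq_mul, ← Matrix.trace_smul, ← toM_centerSU_zpow_mul hN]
  exact congrArg (fun u => (toM u).trace)
    (zpow_mul_plaquette (centerSU_commute hN) _ _ _ _ _ _ _ _)

lemma measurable_mul_left {N : ℕ} (g : SU N) : Measurable fun u : SU N => g * u := by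
  refine Measurable.subtype_mk (Measurable.subtype_mk ?_)
  change Measurable fun u : SU N => toM g * toM u
  refine measurable_pi_lambda _ fun i => measurable_pi_lambda _ fun j => ?_
  change Measurable fun u : SU N => (toM g * toM u) i j
  simp only [Matrix.mul_apply]
  refine Finset.measurable_fun_sum _ fun l _ => Measurable.const_mul ?_ _
  have h : Measurable (toM : SU N → Matrix (Fin N) (Fin N) ℂ) :=
    measurable_subtype_coe.comp measurable_subtype_coe
  exact (measurable_pi_apply j).comp ((measurable_pi_apply l).comp h)

/-- Left multiplication by an element of `SU(N)` as a measurable equivalence. -/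
noncomputable def mulLeftEquiv {N : ℕ} (g : SU N) : SU N ≃ᵐ SU N where
  toEquiv := Equiv.mulLeft g
  measurable_toFun := measurable_mul_left g
  measurable_invFun := measurable_mul_left g⁻¹

lemma integral_comp_centerTwist {d N : ℕ} (hN : N ≠ 0) (L : Fin d → ℕ) [∀ i, NeZero (L i)]
    (μH : Measure (SU N)) [IsProbabilityMeasure μH]
    (hHaar : ∀ g : SU N, Measure.map (fun u => g * u) μH = μH)
    (n : Site L × Fin d → ℤ) (f : Config L N → ℝ) :
    ∫ U, f (centerTwist hN L n U) ∂(Pm L μH) = ∫ U, f U ∂(Pm L μH) := by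
  have h : MeasurePreserving
      (MeasurableEquiv.piCongrRight fun b => mulLeftEquiv (centerSU N hN ^ n b))
      (Pm L μH) (Pm L μH) :=
    measurePreserving_pi (fun _ => μH) (fun _ => μH) fun b =>
      ⟨measurable_mul_left (centerSU N hN ^ n b), hHaar _⟩
  exact h.integral_comp' f

/-- The Gibbs weight in which the plaquette variable at `x` in the `μν`-plane is multiplied
by the phase `s x`. -/
noncomputable def twistedWeight {d N : ℕ} (L : Fin d → ℕ) [∀ i, NeZero (L i)] (β : ℝ)
    (μ ν : Fin d) (s : Site L → ℂ) (U : Config L N) : ℝ :=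
  Real.exp (S0 L β U + β / N * ∑ x : Site L, ((s x - 1) * (toM (plaqSU L U x μ ν)).trace).re)

lemma Ovort_mul_wt {d N : ℕ} (L : Fin d → ℕ) [∀ i, NeZero (L i)] (β : ℝ) {μ ν : Fin d}
    (c1 : ZMod (L μ)) (c2 : ZMod (L ν)) (k : ℕ) (U : Config L N) :
    Ovort L β c1 c2 k U * wt L β U =
      twistedWeight L β μ ν (fun x => if x μ = c1 ∧ x ν = c2 then zc N ^ k else 1) U := by
  rw [Ovort, wt, twistedWeight, ← Real.exp_add, add_comm]
  congr 3
  refine Finset.sum_congr rfl fun x _ => ?_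
  split_ifs <;> simp [sub_mul]

lemma Ovort_mul_twistedWeight {d N : ℕ} (L : Fin d → ℕ) [∀ i, NeZero (L i)] (β : ℝ)
    {μ ν : Fin d} (c1 : ZMod (L μ)) (c2 : ZMod (L ν)) (k : ℕ) (s : Site L → ℂ)
    (hs : ∀ x, x μ = c1 ∧ x ν = c2 → s x = 1) (U : Config L N) :
    Ovort L β c1 c2 k U * twistedWeight L β μ ν s U =
      twistedWeight L β μ ν (fun x => if x μ = c1 ∧ x ν = c2 then zc N ^ k else s x) U := by
  rw [Ovort, twistedWeight, twistedWeight, ← Real.exp_add, add_left_comm, ← mul_add,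
    ← Finset.sum_add_distrib]
  congr 3
  refine Finset.sum_congr rfl fun x _ => ?_
  split_ifs with h
  · simp [hs x h, sub_mul]
  · simp

/-- A `Z_N` transformation whose coboundary is supported on the `μν`-plaquettes multiplies the
phases of the twisted weight by that coboundary. -/
lemma twistedWeight_centerTwist {d N : ℕ} (hN : N ≠ 0) (L : Fin d → ℕ) [∀ i, NeZero (L i)]
    (β : ℝ) {μ ν : Fin d} (hμν : μ < ν) (n : Site L × Fin d → ℤ)
    (t : Site L → ℤ)
    (hn : ∀ x α γ, α < γ → n (x, α) + n (x + e L α, γ) - n (x + e L γ, α) - n (x, γ) =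
      if α = μ ∧ γ = ν then t x else 0)
    (s : Site L → ℂ) (U : Config L N) :
    twistedWeight L β μ ν s (centerTwist hN L n U) =
      twistedWeight L β μ ν (fun x => s x * zc N ^ t x) U := by
  have h0 : S0 L β (centerTwist hN L n U) = S0 L β U +
      β / N * ∑ x : Site L, ((zc N ^ t x - 1) * (toM (plaqSU L U x μ ν)).trace).re := by
    rw [S0, S0, ← mul_add, ← Finset.sum_add_distrib]
    congr 1
    refine Finset.sum_congr rfl fun x _ => ?_
    have : ((zc N ^ t x - 1) * (toM (plaqSU L U x μ ν)).trace).re =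
        ∑ α : Fin d, ∑ γ : Fin d, if α = μ ∧ γ = ν then
          ((zc N ^ t x - 1) * (toM (plaqSU L U x μ ν)).trace).re else 0 := by
      simp [ite_and]
    rw [this, ← Finset.sum_add_distrib]
    refine Finset.sum_congr rfl fun α _ => ?_
    rw [← Finset.sum_add_distrib]
    refine Finset.sum_congr rfl fun γ _ => ?_
    by_cases hαγ : α < γ
    · rw [if_pos hαγ, if_pos hαγ, trace_plaqSU_centerTwist, hn x α γ hαγ]
      by_cases h : α = μ ∧ γ = ν
      · obtain ⟨rfl, rfl⟩ := h
        simp [sub_mul]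
      · simp [h]
    · have h : ¬(α = μ ∧ γ = ν) := by
        rintro ⟨rfl, rfl⟩
        exact hαγ hμν
      simp [hαγ, h]
  rw [twistedWeight, twistedWeight, h0, add_assoc, ← mul_add, ← Finset.sum_add_distrib]
  congr 3
  refine Finset.sum_congr rfl fun x _ => ?_
  rw [trace_plaqSU_centerTwist, hn x μ ν hμν, if_pos ⟨rfl, rfl⟩, ← Complex.add_re]
  congr 1
  ring

/-- Homologous vortices differ by the coboundary of an integer-valued function on links. -/
lemma exists_coboundary_eq_vortex_sub {d : ℕ} (L : Fin d → ℕ) [∀ i, NeZero (L i)]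
    {μ ν : Fin d} (hμν : μ < ν) (c c' : ZMod (L μ) × ZMod (L ν)) :
    ∃ n : Site L × Fin d → ℤ, ∀ x α γ, α < γ →
      n (x, α) + n (x + e L α, γ) - n (x + e L γ, α) - n (x, γ) =
        if α = μ ∧ γ = ν then (if x μ = c.1 ∧ x ν = c.2 then 1 else 0) -
          (if x μ = c'.1 ∧ x ν = c'.2 then 1 else 0) else 0 := by
  obtain ⟨s, t, hst⟩ := exists_coboundary_eq_indicator_sub (L μ) (L ν) c c'
  refine ⟨fun b => if b.2 = μ then s (b.1 μ) (b.1 ν) else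
    if b.2 = ν then t (b.1 μ) (b.1 ν) else 0, fun x α γ hαγ => ?_⟩
  have hne : μ ≠ ν := hμν.ne
  by_cases h : α = μ ∧ γ = ν
  · obtain ⟨rfl, rfl⟩ := h
    simpa [e, hne, hne.symm] using hst (x α) (x γ)
  · rw [if_neg h]
    have hsite (ρ : Fin d) (h1 : ρ ≠ μ) (h2 : ρ ≠ ν) :
        (x + e L ρ) μ = x μ ∧ (x + e L ρ) ν = x ν := by
      simp [e, h1.symm, h2.symm]
    by_cases a1 : α = μ <;> by_cases a2 : α = ν <;> by_cases b1 : γ = μ <;>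
      by_cases b2 : γ = ν <;> grind

/-- For two distinct homologous vortices `V` (coordinates `c`) and `V′` (coordinates `c′`)
for the same pair of directions `(μ, ν)`, the vortex creation operators satisfy
`⟨O^[k][V] · O^[k′][V′]⟩ = ⟨O^[(k+k′) mod N][V]⟩`. -/
theorem vortex_product_rule
    {d N : ℕ} (hN : 2 ≤ N) (L : Fin d → ℕ) [∀ i, NeZero (L i)]
    (β : ℝ)
    (μH : Measure (SU N)) [IsProbabilityMeasure μH]
    (hHaar : ∀ g : SU N, Measure.map (fun u => g * u) μH = μH)
    (μ ν : Fin d) (hμν : μ < ν)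
    (c c' : ZMod (L μ) × ZMod (L ν)) (hcc : c ≠ c')
    (k k' : ℕ) (hk : k < N) (hk' : k' < N) :
    expecR L μH β (fun U => Ovort L β c.1 c.2 k U * Ovort L β c'.1 c'.2 k' U) =
      expecR L μH β (Ovort L β c.1 c.2 ((k + k') % N)) := by
  have hN0 : N ≠ 0 := by omega
  obtain ⟨n, hn⟩ := exists_coboundary_eq_vortex_sub L hμν c c'
  have hdisj (x : Site L) (h : x μ = c.1 ∧ x ν = c.2) : ¬(x μ = c'.1 ∧ x ν = c'.2) :=
    fun h' => hcc (Prod.ext (h.1.symm.trans h'.1) (h.2.symm.trans h'.2))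
  rw [expecR, expecR]
  congr 1
  simp only [mul_assoc, Ovort_mul_wt]
  rw [← integral_comp_centerTwist hN0 L μH hHaar (fun b => k' * n b)]
  refine integral_congr_ae (Filter.Eventually.of_forall fun U => ?_)
  beta_reduce
  rw [Ovort_mul_twistedWeight L β c.1 c.2 k _ (fun x h => if_neg (hdisj x h)),
    twistedWeight_centerTwist hN0 L β hμν (fun b => k' * n b)
      (fun x => k' * ((if x μ = c.1 ∧ x ν = c.2 then 1 else 0) -
        (if x μ = c'.1 ∧ x ν = c'.2 then 1 else 0)))
      (fun x α γ h => by
        rw [← mul_add, ← mul_sub, ← mul_sub, hn x α γ h, mul_ite, mul_zero])]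
  congr 1
  funext x
  by_cases h : x μ = c.1 ∧ x ν = c.2
  · simp only [if_pos h, if_neg (hdisj x h), zc_pow_mod hN0, pow_add]
    simp
  · by_cases h' : x μ = c'.1 ∧ x ν = c'.2
    · simp only [if_neg h, if_pos h']
      simp [zc_ne_zero]
    · simp [if_neg h, if_neg h']

end TYLGT
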